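/- arXiv:1706.04846 — 11 statements merged into one kernel-verified Lean document; each statement's English description precedes it below -/
import Mathlib

section
/- Let C be a nonempty closed convex subset and D a nonempty closed subset of a Euclidean space X with C ∩ D ≠ ∅. Let x̄ ∈ C ∩ D, let δ > 0, let x ∈ X with ‖x − x̄‖ ≤ δ, and let x₊ ∈ T_{C,D}(x). Then ‖x₊ − x̄‖ ≤ 2‖x − x̄‖ ≤ 2δ; in particular T_{C,D} maps the closed ball B(x̄, δ) into the closed ball B(x̄, 2δ). -/
open Metric

/-- The (possibly set-valued) projector onto a set `C`. -/
def projSet {X : Type*} [NormedAddCommGroup X] (C : Set X) (x : X) : Set X :=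
  {c | c ∈ C ∧ ‖x - c‖ = infDist x C}

/-- The (possibly set-valued) reflector across a set `C`. -/
def reflSet {X : Type*} [NormedAddCommGroup X] (C : Set X) (x : X) : Set X :=
  {w | ∃ c ∈ projSet C x, w = 2 • c - x}

/-- The Douglas–Rachford operator `T_{C,D}(x) = {(x+w)/2 : w ∈ R_D(v), v ∈ R_C(x)}`. -/
def drSet {X : Type*} [NormedAddCommGroup X] [Module ℝ X] (C D : Set X) (x : X) : Set X :=
  {z | ∃ v ∈ reflSet C x, ∃ w ∈ reflSet D v, z = (2 : ℝ)⁻¹ • (x + w)}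

/-- The variational inequality for a projection onto a convex set. -/
lemma inner_sub_le_zero_of_mem_projSet {X : Type*} [NormedAddCommGroup X]
    [InnerProductSpace ℝ X] {C : Set X} (hC : Convex ℝ C) {x c y : X}
    (hc : c ∈ projSet C x) (hy : y ∈ C) : inner ℝ (x - c) (y - c) ≤ 0 := by
  refine (norm_eq_iInf_iff_real_inner_le_zero hC hc.1).1 ?_ y hy
  simpa only [dist_eq_norm] using hc.2.trans infDist_eq_iInf

/-- Reflection across a convex set does not increase the distance to points of the set. -/
lemma norm_sub_le_of_mem_reflSet_of_convex {X : Type*} [NormedAddCommGroup X]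
    [InnerProductSpace ℝ X] {C : Set X} (hC : Convex ℝ C) {x v y : X}
    (hv : v ∈ reflSet C x) (hy : y ∈ C) : ‖v - y‖ ≤ ‖x - y‖ := by
  obtain ⟨c, hc, rfl⟩ := hv
  have h := inner_sub_le_zero_of_mem_projSet hC hc hy
  have hv : 2 • c - x - y = -((x - c) + (y - c)) := by rw [two_nsmul]; abel
  have hx : x - y = (x - c) - (y - c) := by abel
  rw [hv, hx, norm_neg]
  refine (sq_le_sq₀ (norm_nonneg _) (norm_nonneg _)).1 ?_
  rw [norm_add_sq_real, norm_sub_sq_real (x - c) (y - c)]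
  linarith

/-- Reflection across an arbitrary set at most triples the distance to points of the set. -/
lemma norm_sub_le_three_mul_of_mem_reflSet {X : Type*} [NormedAddCommGroup X]
    {D : Set X} {v w y : X} (hw : w ∈ reflSet D v) (hy : y ∈ D) :
    ‖w - y‖ ≤ 3 * ‖v - y‖ := by
  obtain ⟨d, ⟨-, hd⟩, rfl⟩ := hw
  have h : ‖v - d‖ ≤ ‖v - y‖ := by
    rw [hd, ← dist_eq_norm]
    exact infDist_le_dist_of_mem hy
  have hw : 2 • d - v - y = (v - y) - (v - d) - (v - d) := by rw [two_nsmul]; abel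
  rw [hw]
  linarith [norm_sub_le ((v - y) - (v - d)) (v - d), norm_sub_le (v - y) (v - d)]

/-- If `C` is nonempty closed convex, `D` is nonempty closed, `C ∩ D ≠ ∅`,
`x̄ ∈ C ∩ D`, `δ > 0`, `‖x - x̄‖ ≤ δ` and `x₊ ∈ T_{C,D}(x)`, then
`‖x₊ - x̄‖ ≤ 2‖x - x̄‖ ≤ 2δ`. -/
theorem stmt0 {X : Type*} [NormedAddCommGroup X] [InnerProductSpace ℝ X]
    [FiniteDimensional ℝ X]
    (C D : Set X) (hCne : C.Nonempty) (hCc : IsClosed C) (hCv : Convex ℝ C)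
    (hDne : D.Nonempty) (hDc : IsClosed D) (hCD : (C ∩ D).Nonempty)
    (xbar : X) (hxbar : xbar ∈ C ∩ D) (δ : ℝ) (hδ : 0 < δ)
    (x : X) (hx : ‖x - xbar‖ ≤ δ) (xp : X) (hxp : xp ∈ drSet C D x) :
    ‖xp - xbar‖ ≤ 2 * ‖x - xbar‖ ∧ 2 * ‖x - xbar‖ ≤ 2 * δ := by
  refine ⟨?_, by linarith⟩
  obtain ⟨v, hv, w, hw, rfl⟩ := hxp
  have h₁ := norm_sub_le_of_mem_reflSet_of_convex hCv hv hxbar.1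
  have h₂ := norm_sub_le_three_mul_of_mem_reflSet hw hxbar.2
  have h : (2 : ℝ)⁻¹ • (x + w) - xbar = (2 : ℝ)⁻¹ • ((x - xbar) + (w - xbar)) := by module
  rw [h, norm_smul, Real.norm_of_nonneg (by norm_num)]
  linarith [norm_add_le (x - xbar) (w - xbar)]
end

section
/- Suppose in addition that f is convex. Let (x, ρ) ∈ dom f × ℝ and let (p, f(p)) ∈ P_B(x, ρ) with p in the interior of dom f. Then there exists v ∈ ∂f(p) (the convex subdifferential) such that x = p + (f(p) − ρ)·v. -/
open Set Metric Filter
open scoped InnerProductSpace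

/-- The Euclidean (ℓ²) distance on the product `X × ℝ`. -/
noncomputable def dist2 {X : Type*} [NormedAddCommGroup X] (z w : X × ℝ) : ℝ :=
  Real.sqrt (‖z.1 - w.1‖ ^ 2 + (z.2 - w.2) ^ 2)

/-- The graph `B = {(x, ρ) : x ∈ dom f, f(x) = ρ}` of the extended-real-valued function
encoded by its effective domain `s` and its real values `f` on `s`. -/
def grph {X : Type*} (s : Set X) (f : X → ℝ) : Set (X × ℝ) :=
  {p | p.1 ∈ s ∧ f p.1 = p.2}

/-- The (possibly set-valued) projector onto the graph `B`, for the Euclidean metric on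
`X × ℝ`: the set of points of `B` nearest to `z`. -/
noncomputable def projB {X : Type*} [NormedAddCommGroup X] (s : Set X) (f : X → ℝ)
    (z : X × ℝ) : Set (X × ℝ) :=
  {b | b ∈ grph s f ∧ ∀ b' ∈ grph s f, dist2 z b ≤ dist2 z b'}

/-- The reflector across `A = X × {0}`: `R_A(x, ρ) = (x, -ρ)`. -/
def reflA {X : Type*} (z : X × ℝ) : X × ℝ := (z.1, -z.2)

/-- The Douglas–Rachford operator `T_{A,B}(z) = {(z + w)/2 : w ∈ R_B(R_A z)}`,
where `R_B(v) = {2b - v : b ∈ P_B(v)}`. -/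
noncomputable def drT {X : Type*} [NormedAddCommGroup X] [Module ℝ X] (s : Set X)
    (f : X → ℝ) (z : X × ℝ) : Set (X × ℝ) :=
  {w | ∃ b ∈ projB s f (reflA z), w = (2 : ℝ)⁻¹ • (z + (2 • b - reflA z))}

/-- The convex subdifferential of the extended function encoded by `(s, F)` at `p`:
`∂F(p) = {v : ∀ y, F(p) + ⟨v, y - p⟩ ≤ F(y)}` (points outside `s` have value `+∞`,
so only `y ∈ s` matters; if `p ∉ s` then `F(p) = +∞` and the subdifferential is empty). -/
def subdiff {X : Type*} [NormedAddCommGroup X] [InnerProductSpace ℝ X]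
    (s : Set X) (F : X → ℝ) (p : X) : Set X :=
  {v | p ∈ s ∧ ∀ y ∈ s, F p + ⟪v, y - p⟫_ℝ ≤ F y}

open Topology

/-- First-order necessary condition along a ray. -/
lemma nonneg_of_eventually_nonneg_linear_add_quadratic {a b : ℝ}
    (h : ∀ᶠ l : ℝ in 𝓝[>] 0, 0 ≤ l * a + l ^ 2 * b) : 0 ≤ a := by
  have hlim : Tendsto (fun l : ℝ => a + l * b) (𝓝[>] 0) (𝓝 a) := by
    have hc : Continuous fun l : ℝ => a + l * b := by fun_prop
    simpa using (hc.tendsto 0).mono_left nhdsWithin_le_nhds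
  refine ge_of_tendsto hlim ?_
  filter_upwards [h, self_mem_nhdsWithin] with l hl hl0
  have hl0 : 0 < l := hl0
  refine (mul_nonneg_iff_of_pos_left hl0).1 ?_
  linarith [show l * (a + l * b) = l * a + l ^ 2 * b by ring]

lemma tendsto_add_smul_nhdsGT_zero {X : Type*} [NormedAddCommGroup X] [NormedSpace ℝ X]
    (p d : X) : Tendsto (fun l : ℝ => p + l • d) (𝓝[>] 0) (𝓝 p) := by
  have hc : Continuous fun l : ℝ => p + l • d := by fun_prop
  simpa using (hc.tendsto 0).mono_left nhdsWithin_le_nhds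

lemma ConvexOn.add_smul_sub_le {X : Type*} [AddCommGroup X] [Module ℝ X]
    {s : Set X} {f : X → ℝ} (hf : ConvexOn ℝ s f) {p y : X} (hp : p ∈ s) (hy : y ∈ s)
    {l : ℝ} (h0 : 0 ≤ l) (h1 : l ≤ 1) :
    f (p + l • (y - p)) ≤ f p + l * (f y - f p) := by
  have h := hf.2 hp hy (sub_nonneg.2 h1) h0 (by ring)
  rw [show (1 - l) • p + l • y = p + l • (y - p) by module] at h
  simp only [smul_eq_mul] at h
  linarith

lemma eventually_nhdsGT_zero_mem_Ioc : ∀ᶠ l : ℝ in 𝓝[>] 0, 0 < l ∧ l ≤ 1 :=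
  Filter.mem_of_superset (Ioc_mem_nhdsGT (zero_lt_one' ℝ)) fun _ hl => hl

/-- A convex function is subdifferentiable at every interior point of its domain. -/
lemma ConvexOn.subdiff_nonempty {X : Type*} [NormedAddCommGroup X] [InnerProductSpace ℝ X]
    [FiniteDimensional ℝ X] {s : Set X} {f : X → ℝ} (hf : ConvexOn ℝ s f) {p : X}
    (hp : p ∈ interior s) : (subdiff s f p).Nonempty := by
  have hps : p ∈ s := interior_subset hp
  have hfi : ConvexOn ℝ (interior s) f := hf.subset interior_subset hf.1.interior
  have hopen : IsOpen {q : X × ℝ | q.1 ∈ interior s ∧ f q.1 < q.2} := by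
    have hfst : ContinuousOn (fun q : X × ℝ => q.2 - f q.1) (Prod.fst ⁻¹' interior s) :=
      continuous_snd.continuousOn.sub
        (hf.continuousOn_interior.comp continuous_fst.continuousOn fun _ hq => hq)
    convert hfst.isOpen_inter_preimage (isOpen_interior.preimage continuous_fst)
      (isOpen_Ioi (a := (0 : ℝ))) using 1
    ext q
    simp
  obtain ⟨L, hL⟩ := geometric_hahn_banach_point_open hfi.convex_strict_epigraph hopen
    (x := (p, f p)) (by simp)
  have hsplit (y : X) (r : ℝ) : L (y, r) = L (y, 0) + r * L (0, 1) := by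
    rw [← smul_eq_mul, ← map_smul, ← map_add]
    simp
  have hc : 0 < L (0, 1) := by
    have h := hL (p, f p + 1) ⟨hp, by simp⟩
    rw [hsplit p (f p), hsplit p (f p + 1)] at h
    linarith
  have hint (y : X) (hy : y ∈ interior s) :
      L (p, 0) + f p * L (0, 1) ≤ L (y, 0) + f y * L (0, 1) := by
    refine le_of_forall_pos_lt_add fun ε hε => ?_
    have h := hL (y, f y + ε / L (0, 1)) ⟨hy, by simp; positivity⟩
    rw [hsplit p, hsplit y, add_mul, div_mul_cancel₀ _ hc.ne'] at h
    linarith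
  let φ : StrongDual ℝ X := -((L (0, 1))⁻¹ • L.comp (.inl ℝ X ℝ))
  refine ⟨(InnerProductSpace.toDual ℝ X).symm φ, hps, fun y hy => ?_⟩
  rw [InnerProductSpace.toDual_symm_apply]
  have key : 0 ≤ L (y - p, 0) + (f y - f p) * L (0, 1) := by
    refine nonneg_of_eventually_nonneg_linear_add_quadratic (b := 0) ?_
    filter_upwards [eventually_nhdsGT_zero_mem_Ioc,
      tendsto_add_smul_nhdsGT_zero p (y - p) (isOpen_interior.mem_nhds hp)] with l hl hli
    have h := hint _ hli
    have hadd : L (p + l • (y - p), 0) = L (p, 0) + l * L (y - p, 0) := by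
      rw [← smul_eq_mul, ← map_smul, ← map_add]
      simp
    have hle := mul_le_mul_of_nonneg_right
      (hf.add_smul_sub_le hps hy hl.1.le hl.2) hc.le
    rw [hadd] at h
    linarith
  have hφ : φ (y - p) = -((L (0, 1))⁻¹ * L (y - p, 0)) := by simp [φ]
  have hmul := mul_nonneg (inv_nonneg.2 hc.le) key
  have hcancel : (L (0, 1))⁻¹ * ((f y - f p) * L (0, 1)) = f y - f p := by field_simp
  rw [mul_add, hcancel] at hmul
  rw [hφ]
  linarith

/-- Stationarity along a ray: if, near `p`, the squared height `(f - ρ)²` is bounded on the ray by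
a quadratic with slope `m`, then `⟪x - p, d⟫` is at most half of `m`. -/
lemma inner_le_of_mem_projB {X : Type*} [NormedAddCommGroup X] [InnerProductSpace ℝ X]
    {s : Set X} {f : X → ℝ} {x p d : X} {ρ m c : ℝ} (hp : (p, f p) ∈ projB s f (x, ρ))
    (hray : ∀ᶠ l : ℝ in 𝓝[>] 0, p + l • d ∈ s)
    (hbound : ∀ᶠ l : ℝ in 𝓝[>] 0,
      (f (p + l • d) - ρ) ^ 2 ≤ (f p - ρ) ^ 2 + l * (2 * m) + l ^ 2 * c) :
    ⟪x - p, d⟫_ℝ ≤ m := by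
  suffices h : 0 ≤ 2 * m - 2 * ⟪x - p, d⟫_ℝ by linarith
  refine nonneg_of_eventually_nonneg_linear_add_quadratic (b := c + ‖d‖ ^ 2) ?_
  filter_upwards [hray, hbound] with l hl hb
  have hmin : ‖x - p‖ ^ 2 + (ρ - f p) ^ 2
      ≤ ‖x - (p + l • d)‖ ^ 2 + (ρ - f (p + l • d)) ^ 2 :=
    (Real.sqrt_le_sqrt_iff (by positivity)).1 (hp.2 (p + l • d, f (p + l • d)) ⟨hl, rfl⟩)
  have hnorm : ‖x - (p + l • d)‖ ^ 2
      = ‖x - p‖ ^ 2 - 2 * (l * ⟪x - p, d⟫_ℝ) + l ^ 2 * ‖d‖ ^ 2 := by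
    rw [← sub_sub, norm_sub_sq_real, real_inner_smul_right, norm_smul, mul_pow,
      Real.norm_eq_abs, sq_abs]
  rw [hnorm] at hmin
  nlinarith

/-- If `f` is moreover convex, `(x, ρ) ∈ dom f × ℝ`, `(p, f(p)) ∈ P_B(x, ρ)` and `p` lies
in the interior of `dom f`, then `x = p + (f(p) - ρ) v` for some `v ∈ ∂f(p)`. -/
theorem stmt5 {X : Type*} [NormedAddCommGroup X] [InnerProductSpace ℝ X]
    [FiniteDimensional ℝ X]
    (s : Set X) (f : X → ℝ) (hs : s.Nonempty) (hconv : ConvexOn ℝ s f)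
    (hB : IsClosed (grph s f))
    (x : X) (hx : x ∈ s) (ρ : ℝ)
    (p : X) (hp : (p, f p) ∈ projB s f (x, ρ)) (hpint : p ∈ interior s) :
    ∃ v ∈ subdiff s f p, x = p + (f p - ρ) • v := by
  have hps : p ∈ s := interior_subset hpint
  have hray (d : X) : ∀ᶠ l : ℝ in 𝓝[>] 0, p + l • d ∈ s :=
    tendsto_add_smul_nhdsGT_zero p d (mem_interior_iff_mem_nhds.1 hpint)
  have hlim (d : X) : Tendsto (fun l : ℝ => f (p + l • d)) (𝓝[>] 0) (𝓝 (f p)) :=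
    (hconv.continuousOn_interior.continuousAt (isOpen_interior.mem_nhds hpint)).tendsto.comp
      (tendsto_add_smul_nhdsGT_zero p d)
  obtain ⟨u, hu⟩ := hconv.subdiff_nonempty hpint
  rcases lt_trichotomy ρ (f p) with hlt | heq | hgt
  · have ht : 0 < f p - ρ := sub_pos.2 hlt
    refine ⟨(f p - ρ)⁻¹ • (x - p), ⟨hps, fun y hy => ?_⟩, ?_⟩
    · have h : ⟪x - p, y - p⟫_ℝ ≤ (f p - ρ) * (f y - f p) := by
        refine inner_le_of_mem_projB (c := (f y - f p) ^ 2) hp (hray _) ?_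
        filter_upwards [eventually_nhdsGT_zero_mem_Ioc,
          (hlim (y - p)).eventually_const_lt hlt] with l hl hpos
        have hle := hconv.add_smul_sub_le hps hy hl.1.le hl.2
        have hsq := pow_le_pow_left₀ (sub_pos.2 hpos).le (sub_le_sub_right hle ρ) 2
        linarith
      rw [real_inner_smul_left]
      have := (inv_mul_le_iff₀ ht).2 h
      linarith
    · rw [smul_inv_smul₀ ht.ne']
      abel
  · refine ⟨u, hu, ?_⟩
    obtain ⟨K, t, ht, hK⟩ := hconv.locallyLipschitzOn_interior hpint
    rw [isOpen_interior.nhdsWithin_eq hpint] at ht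
    have h : ⟪x - p, x - p⟫_ℝ ≤ 0 := by
      refine inner_le_of_mem_projB (c := (K * ‖x - p‖) ^ 2) hp (hray _) ?_
      filter_upwards [tendsto_add_smul_nhdsGT_zero p (x - p) ht] with l hl
      have hd := hK.dist_le_mul _ hl _ (mem_of_mem_nhds ht)
      rw [Real.dist_eq, dist_eq_norm, add_sub_cancel_left, norm_smul, Real.norm_eq_abs] at hd
      have hsq := pow_le_pow_left₀ (abs_nonneg _) hd 2
      have hexp : (K * (|l| * ‖x - p‖)) ^ 2 = l ^ 2 * (K * ‖x - p‖) ^ 2 := by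
        rw [mul_pow, mul_pow, sq_abs]
        ring
      rw [sq_abs, hexp] at hsq
      rw [heq]
      linarith
    rw [real_inner_self_nonpos, sub_eq_zero] at h
    simp [h, heq]
  · refine ⟨u, hu, ?_⟩
    have h (d : X) : ⟪x - p, d⟫_ℝ ≤ (f p - ρ) * ⟪u, d⟫_ℝ := by
      refine inner_le_of_mem_projB (c := ⟪u, d⟫_ℝ ^ 2) hp (hray _) ?_
      filter_upwards [hray d, (hlim d).eventually_lt_const hgt] with l hl hneg
      have hle := hu.2 _ hl
      rw [add_sub_cancel_left, real_inner_smul_right] at hle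
      have hsq := pow_le_pow_left₀ (sub_pos.2 hneg).le (sub_le_sub_left hle ρ) 2
      linarith
    have hzero : ⟪x - p - (f p - ρ) • u, x - p - (f p - ρ) • u⟫_ℝ ≤ 0 := by
      rw [inner_sub_left, real_inner_smul_left]
      exact sub_nonpos.2 (h _)
    rw [real_inner_self_nonpos, sub_eq_zero] at hzero
    rw [← hzero]
    abel
end

section
/- Let (x, ρ) ∈ dom f × ℝ and let (x₊, ρ₊) ∈ T_{A,B}(x, ρ). Then (x₊, f(x₊)) ∈ P_B(x, −ρ), ρ₊ = ρ + f(x₊), and ‖x − x₊‖² ≤ (f(x) − f(x₊))·(f(x) + f(x₊) + 2ρ). -/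
open Set Metric Filter
open scoped InnerProductSpace

/-- One DR step: if `(x, ρ) ∈ dom f × ℝ` and `(x₊, ρ₊) ∈ T_{A,B}(x, ρ)`, then
`(x₊, f(x₊)) ∈ P_B(x, -ρ)`, `ρ₊ = ρ + f(x₊)`, and
`‖x - x₊‖² ≤ (f(x) - f(x₊))(f(x) + f(x₊) + 2ρ)`. -/
theorem stmt6 {X : Type*} [NormedAddCommGroup X] [InnerProductSpace ℝ X]
    [FiniteDimensional ℝ X]
    (s : Set X) (f : X → ℝ) (hs : s.Nonempty) (hB : IsClosed (grph s f))
    (x : X) (hx : x ∈ s) (ρ : ℝ)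
    (xp : X) (ρp : ℝ) (hstep : (xp, ρp) ∈ drT s f (x, ρ)) :
    (xp, f xp) ∈ projB s f (x, -ρ) ∧ ρp = ρ + f xp ∧
    ‖x - xp‖ ^ 2 ≤ (f x - f xp) * (f x + f xp + 2 * ρ) := by
  obtain ⟨⟨y, r⟩, hproj, hstep⟩ := hstep
  obtain rfl : f y = r := hproj.1.2
  simp only [reflA, Prod.ext_iff, Prod.smul_fst, Prod.smul_snd, Prod.fst_add, Prod.snd_add,
    Prod.fst_sub, Prod.snd_sub] at hstep
  obtain ⟨hxp, hρp⟩ := hstep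
  obtain rfl : xp = y := by rw [hxp]; module
  refine ⟨hproj, ?_, ?_⟩
  · rw [hρp, smul_eq_mul, nsmul_eq_mul]
    push_cast
    ring
  · have hle := hproj.2 (x, f x) ⟨hx, rfl⟩
    simp only [dist2, reflA, sub_self, norm_zero] at hle
    rw [Real.sqrt_le_sqrt_iff (by positivity)] at hle
    linarith
end

section
/- Suppose in addition that f is convex. Let (x, ρ) ∈ dom f × ℝ, let (x₊, ρ₊) ∈ T_{A,B}(x, ρ), and suppose 0 ∈ ∂f(x₊) (the convex subdifferential). Then either x₊ = x, or 0 ∉ ∂f(x). -/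
open Set Metric Filter
open scoped InnerProductSpace

/-- If `f` is moreover convex, `(x, ρ) ∈ dom f × ℝ`, `(x₊, ρ₊) ∈ T_{A,B}(x, ρ)` and
`0 ∈ ∂f(x₊)`, then either `x₊ = x` or `0 ∉ ∂f(x)`. -/
theorem stmt7 {X : Type*} [NormedAddCommGroup X] [InnerProductSpace ℝ X]
    [FiniteDimensional ℝ X]
    (s : Set X) (f : X → ℝ) (hs : s.Nonempty) (hconv : ConvexOn ℝ s f)
    (hB : IsClosed (grph s f))
    (x : X) (hx : x ∈ s) (ρ : ℝ)
    (xp : X) (ρp : ℝ) (hstep : (xp, ρp) ∈ drT s f (x, ρ))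
    (hsub : (0 : X) ∈ subdiff s f xp) :
    xp = x ∨ (0 : X) ∉ subdiff s f x := by
  rw [or_iff_not_imp_right, not_not]
  intro hsubx
  obtain ⟨b, ⟨⟨_, hbf⟩, hmin⟩, hw⟩ := hstep
  have hb : xp = b.1 := by
    have h1 := congrArg Prod.fst hw
    simp only [reflA, Prod.smul_fst, Prod.fst_add, Prod.fst_sub] at h1
    rw [h1]
    module
  have hle : f x ≤ f xp := by simpa using hsubx.2 xp hsub.1
  have hge : f xp ≤ f x := by simpa using hsub.2 x hx
  have hval : f x = b.2 := by rw [← hbf, ← hb]; exact le_antisymm hle hge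
  have hdist := hmin (x, f x) ⟨hx, rfl⟩
  simp only [dist2, reflA, hval] at hdist
  rw [Real.sqrt_le_sqrt_iff (by positivity), sub_self, norm_zero] at hdist
  have hnorm : ‖x - b.1‖ = 0 := by nlinarith [norm_nonneg (x - b.1)]
  rw [hb, sub_eq_zero.mp (norm_eq_zero.mp hnorm)]
end

section
/- Every (x, ρ) ∈ Fix T_{A,B} satisfies f(x) = 0 and (x, 0) ∈ P_B(x, −ρ). Consequently, A ∩ B ⊆ Fix T_{A,B} ⊆ f⁻¹(0) × ℝ, and P_A(Fix T_{A,B}) = A ∩ B. -/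
open Set Metric Filter
open scoped InnerProductSpace

/-- The fixed point set of the Douglas–Rachford operator. -/
noncomputable def fixT {X : Type*} [NormedAddCommGroup X] [Module ℝ X]
    (s : Set X) (f : X → ℝ) : Set (X × ℝ) :=
  {z | z ∈ drT s f z}

/-- The fixed point equation says precisely that the selected projection is `(x, 0)`. -/
theorem mem_fixT_iff {X : Type*} [NormedAddCommGroup X] [Module ℝ X]
    {s : Set X} {f : X → ℝ} {z : X × ℝ} :
    z ∈ fixT s f ↔ (z.1, (0 : ℝ)) ∈ projB s f (z.1, -z.2) := by
  have key (b : X × ℝ) :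
      z = (2 : ℝ)⁻¹ • (z + (2 • b - reflA z)) ↔ b = (z.1, (0 : ℝ)) := by
    have h : (2 : ℝ)⁻¹ • (z + (2 • b - reflA z)) = b + (0, z.2) := by
      ext
      · simp only [reflA, Prod.smul_fst, Prod.fst_add, Prod.fst_sub]
        module
      · simp [reflA]
        ring
    rw [h, eq_comm (a := z), ← eq_sub_iff_add_eq]
    simp [Prod.ext_iff]
  constructor
  · rintro ⟨b, hb, hz⟩
    exact (key b).1 hz ▸ hb
  · exact fun h => ⟨_, h, (key _).2 rfl⟩

/-- Every point of the graph is its own nearest point. -/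
theorem mem_projB_self {X : Type*} [NormedAddCommGroup X] {s : Set X} {f : X → ℝ}
    {z : X × ℝ} (hz : z ∈ grph s f) : z ∈ projB s f z := by
  refine ⟨hz, fun b _ => ?_⟩
  simp [dist2]

/-- Every `(x, ρ) ∈ Fix T_{A,B}` satisfies `f(x) = 0` and `(x, 0) ∈ P_B(x, -ρ)`.
Consequently `A ∩ B ⊆ Fix T_{A,B} ⊆ f⁻¹(0) × ℝ` and `P_A(Fix T_{A,B}) = A ∩ B`,
where `A = X × {0}` and `B = gra f`. -/
theorem stmt8 {X : Type*} [NormedAddCommGroup X] [InnerProductSpace ℝ X]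
    [FiniteDimensional ℝ X]
    (s : Set X) (f : X → ℝ) (hs : s.Nonempty) (hB : IsClosed (grph s f))
    (hAB : ∃ x ∈ s, f x = 0) :
    (∀ z ∈ fixT s f, (z.1 ∈ s ∧ f z.1 = 0) ∧ (z.1, (0 : ℝ)) ∈ projB s f (z.1, -z.2)) ∧
    ({z : X × ℝ | z.2 = 0} ∩ grph s f) ⊆ fixT s f ∧
    fixT s f ⊆ {z : X × ℝ | z.1 ∈ s ∧ f z.1 = 0} ∧
    (fun z : X × ℝ => (z.1, (0 : ℝ))) '' fixT s f = {z : X × ℝ | z.2 = 0} ∩ grph s f := by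
  have fix_zero : ∀ z ∈ fixT s f, z.1 ∈ s ∧ f z.1 = 0 :=
    fun z hz => (mem_fixT_iff.1 hz).1
  have inter_sub : {z : X × ℝ | z.2 = 0} ∩ grph s f ⊆ fixT s f := by
    rintro ⟨x, ρ⟩ ⟨rfl : ρ = 0, hx⟩
    rw [mem_fixT_iff]
    simpa using mem_projB_self hx
  refine ⟨fun z hz => ⟨fix_zero z hz, mem_fixT_iff.1 hz⟩, inter_sub, fix_zero, ?_⟩
  apply Subset.antisymm
  · rintro _ ⟨z, hz, rfl⟩
    exact ⟨rfl, fix_zero z hz⟩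
  · intro z hz
    exact ⟨z, inter_sub hz, Prod.ext rfl hz.1.symm⟩
end

section
/- Suppose that f attains the minimum value 0 on X, i.e. f(x) ≥ 0 for all x and f⁻¹(0) ≠ ∅. Then A ∩ B ⊆ f⁻¹(0) × [0, +∞) ⊆ Fix T_{A,B}. -/
open Set Metric Filter
open scoped InnerProductSpace

/-- If `f` attains the minimum value `0` on `X` (i.e. `f ≥ 0` everywhere — points
outside `dom f` having value `+∞` — and `f⁻¹(0) ≠ ∅`), then
`A ∩ B ⊆ f⁻¹(0) × [0, ∞) ⊆ Fix T_{A,B}`. -/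
theorem stmt9 {X : Type*} [NormedAddCommGroup X] [InnerProductSpace ℝ X]
    [FiniteDimensional ℝ X]
    (s : Set X) (f : X → ℝ) (hs : s.Nonempty) (hB : IsClosed (grph s f))
    (hnonneg : ∀ x ∈ s, 0 ≤ f x) (hzero : ∃ x ∈ s, f x = 0) :
    ({z : X × ℝ | z.2 = 0} ∩ grph s f) ⊆
      {z : X × ℝ | (z.1 ∈ s ∧ f z.1 = 0) ∧ 0 ≤ z.2} ∧
    {z : X × ℝ | (z.1 ∈ s ∧ f z.1 = 0) ∧ 0 ≤ z.2} ⊆ fixT s f := by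
  refine ⟨fun z ⟨hz, hzs, hfz⟩ => ⟨⟨hzs, hfz.trans hz⟩, le_of_eq (Eq.symm hz)⟩, ?_⟩
  rintro ⟨x, ρ⟩ ⟨⟨hx, hfx⟩, hρ⟩
  refine ⟨(x, 0), ⟨⟨hx, hfx⟩, ?_⟩, ?_⟩
  · rintro ⟨y, r⟩ ⟨hy, hfy⟩
    have hr : 0 ≤ r := (hnonneg y hy).trans_eq hfy
    simp only [dist2, reflA] at hρ ⊢
    apply Real.sqrt_le_sqrt
    rw [sub_self, norm_zero]
    nlinarith [sq_nonneg ‖x - y‖, mul_nonneg hρ hr]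
  · ext
    · simp only [reflA, Prod.smul_fst, Prod.fst_add, Prod.fst_sub]
      module
    · simp only [reflA, Prod.smul_snd, Prod.snd_add, Prod.snd_sub]
      module
end

section
/- Suppose that f is convex with dom f open, and that inf_{x ∈ X} f(x) < min{0, sup_{x ∈ dom f} f(x)}. Let (z_n) = ((x_n, ρ_n)) be a DR sequence (z_{n+1} ∈ T_{A,B}(z_n) for all n, with z_0 ∈ dom f × ℝ). Then the set S := {n ∈ ℕ : f is (Fréchet) differentiable at x_n with ∇f(x_n) = 0} is finite. -/
open Set Metric Filter
open scoped InnerProductSpace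

/-- A critical point of a convex function is a global minimizer. -/
theorem ConvexOn.le_of_hasFDerivAt_zero {X : Type*} [NormedAddCommGroup X] [NormedSpace ℝ X]
    {s : Set X} {f : X → ℝ} (hf : ConvexOn ℝ s f) {x y : X} (hx : x ∈ s) (hy : y ∈ s)
    (hd : HasFDerivAt f (0 : X →L[ℝ] ℝ) x) : f x ≤ f y := by
  have hline : HasDerivAt (fun t : ℝ => f (x + t • (y - x))) 0 0 := by
    have h1 : HasDerivAt (fun t : ℝ => x + t • (y - x)) (y - x) 0 := by
      simpa using ((hasDerivAt_id (0 : ℝ)).smul_const (y - x)).const_add x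
    have h2 : HasFDerivAt f (0 : X →L[ℝ] ℝ) (x + (0 : ℝ) • (y - x)) := by simpa using hd
    exact h2.comp_hasDerivAt (0 : ℝ) h1
  have hlim := hline.tendsto_slope_zero_right
  have hle : (0 : ℝ) ≤ f y - f x := by
    refine le_of_tendsto hlim ?_
    filter_upwards [Ioo_mem_nhdsGT (zero_lt_one (α := ℝ))] with t ht
    have hc := hf.2 hx hy (sub_nonneg.2 ht.2.le) ht.1.le (sub_add_cancel 1 t)
    have he : (1 - t) • x + t • y = x + t • (y - x) := by module
    rw [he] at hc
    simp only [smul_eq_mul, zero_add, zero_smul, add_zero] at hc ⊢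
    rw [inv_mul_le_iff₀ ht.1]
    linarith
  linarith

theorem mem_drT_iff {X : Type*} [NormedAddCommGroup X] [Module ℝ X] {s : Set X}
    {f : X → ℝ} {z w : X × ℝ} :
    w ∈ drT s f z ↔ w.1 ∈ s ∧ w.2 = z.2 + f w.1 ∧
      ∀ y ∈ s, ‖z.1 - w.1‖ ^ 2 + (z.2 + f w.1) ^ 2 ≤ ‖z.1 - y‖ ^ 2 + (z.2 + f y) ^ 2 := by
  have key : ∀ b : X × ℝ, (2 : ℝ)⁻¹ • (z + (2 • b - reflA z)) = (b.1, z.2 + b.2) := by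
    intro b
    ext
    · simp only [reflA, Prod.smul_fst, Prod.fst_add, Prod.fst_sub]
      module
    · simp only [reflA, Prod.smul_snd, Prod.snd_add, Prod.snd_sub, smul_eq_mul, nsmul_eq_mul]
      push_cast
      ring
  have hd : ∀ y : X, dist2 (reflA z) (y, f y) = √(‖z.1 - y‖ ^ 2 + (z.2 + f y) ^ 2) := by
    intro y
    simp only [dist2, reflA]
    congr 2
    ring
  constructor
  · rintro ⟨⟨y, r⟩, ⟨⟨hy, hr⟩, hmin⟩, rfl⟩
    obtain rfl : f y = r := hr
    rw [key]
    refine ⟨hy, rfl, fun y' hy' => ?_⟩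
    have h := hmin (y', f y') ⟨hy', rfl⟩
    rw [hd, hd] at h
    exact (Real.sqrt_le_sqrt_iff (by positivity)).1 h
  · rintro ⟨hw, hw2, hmin⟩
    refine ⟨(w.1, f w.1), ⟨⟨hw, rfl⟩, ?_⟩, ?_⟩
    · rintro ⟨y, r⟩ ⟨hy, hr⟩
      obtain rfl : f y = r := hr
      rw [hd, hd]
      exact Real.sqrt_le_sqrt (hmin y hy)
    · rw [key]
      exact Prod.ext rfl hw2

/-- If a DR step lands on a critical point of `f`, the first coordinate did not move. -/
theorem fst_eq_of_mem_drT_of_hasFDerivAt_zero {X : Type*} [NormedAddCommGroup X]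
    [InnerProductSpace ℝ X] {s : Set X} {f : X → ℝ} (hopen : IsOpen s) {z w : X × ℝ}
    (hw : w ∈ drT s f z) (hd : HasFDerivAt f (0 : X →L[ℝ] ℝ) w.1) : w.1 = z.1 := by
  obtain ⟨hws, -, hmin⟩ := mem_drT_iff.1 hw
  have hloc : IsLocalMin (fun y => ‖z.1 - y‖ ^ 2 + (z.2 + f y) ^ 2) w.1 := by
    filter_upwards [hopen.mem_nhds hws] with y hy using hmin y hy
  have hder := (((hasFDerivAt_id w.1).const_sub z.1).norm_sq).add ((hd.const_add z.2).pow 2)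
  have h := congrArg (fun L : X →L[ℝ] ℝ => L (w.1 - z.1)) (hloc.hasFDerivAt_eq_zero hder)
  simp [← inner_sub_left] at h
  exact sub_eq_zero.1 h

/-- Suppose `f` is convex with `dom f` open, and
`inf f < min {0, sup_{dom f} f}` (equivalently: `inf f < 0` and `inf f < sup_{dom f} f`).
Let `(z_n)` be a DR sequence with `z_0 ∈ dom f × ℝ`.  Then the set of indices `n` such
that `f` is Fréchet differentiable at `x_n` with `∇f(x_n) = 0` is finite. -/
theorem stmt11 {X : Type*} [NormedAddCommGroup X] [InnerProductSpace ℝ X]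
    [FiniteDimensional ℝ X]
    (s : Set X) (f : X → ℝ) (hs : s.Nonempty) (hconv : ConvexOn ℝ s f)
    (hB : IsClosed (grph s f)) (hopen : IsOpen s)
    (hinf0 : ∃ x ∈ s, f x < 0) (hinfsup : ∃ x ∈ s, ∃ y ∈ s, f x < f y)
    (z : ℕ → X × ℝ) (hz0 : (z 0).1 ∈ s) (hz : ∀ n, z (n + 1) ∈ drT s f (z n)) :
    {n : ℕ | (z n).1 ∈ s ∧ HasFDerivAt f (0 : X →L[ℝ] ℝ) ((z n).1)}.Finite := by
  have hstep : ∀ n, HasFDerivAt f (0 : X →L[ℝ] ℝ) (z (n + 1)).1 → (z (n + 1)).1 = (z n).1 :=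
    fun n => fst_eq_of_mem_drT_of_hasFDerivAt_zero hopen (hz n)
  by_contra hinf
  have hback : ∀ n, HasFDerivAt f (0 : X →L[ℝ] ℝ) (z n).1 → (z n).1 = (z 0).1 := by
    intro n
    induction n with
    | zero => exact fun _ => rfl
    | succ n ih =>
      intro h
      have he := hstep n h
      rw [he] at h ⊢
      exact ih h
  have hfreq := Set.not_finite.1 hinf
  have hd0 : HasFDerivAt f (0 : X →L[ℝ] ℝ) (z 0).1 := by
    obtain ⟨n, hn⟩ := hfreq.nonempty
    rw [← hback n hn.2]
    exact hn.2
  have hconst : ∀ n, (z n).1 = (z 0).1 := by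
    intro n
    obtain ⟨N, hN, hnN⟩ := hfreq.exists_gt n
    have hall : ∀ k ≤ N, HasFDerivAt f (0 : X →L[ℝ] ℝ) (z k).1 := fun k hk =>
      Nat.decreasingInduction (motive := fun k _ => HasFDerivAt f (0 : X →L[ℝ] ℝ) (z k).1)
        (fun k _ h => hstep k h ▸ h) hN.2 hk
    exact hback n (hall n hnN.le)
  have hmin : ∀ y ∈ s, f (z 0).1 ≤ f y := fun y hy => hconv.le_of_hasFDerivAt_zero hz0 hy hd0
  obtain ⟨a, ha, ha0⟩ := hinf0
  obtain ⟨u, hu, v, hv, huv⟩ := hinfsup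
  set m := f (z 0).1 with hm
  have hm0 : m < 0 := (hmin a ha).trans_lt ha0
  have hmv : m < f v := (hmin u hu).trans_lt huv
  have hrho : ∀ n : ℕ, (z n).2 = (z 0).2 + n * m := by
    intro n
    induction n with
    | zero => simp
    | succ n ih =>
      rw [(mem_drT_iff.1 (hz n)).2.1, hconst, ih, ← hm]
      push_cast
      ring
  have hbound : ∀ n : ℕ, n * (2 * -m * (f v - m)) ≤
      ‖(z 0).1 - v‖ ^ 2 + ((z 0).2 + f v) ^ 2 - ((z 0).2 + m) ^ 2 := by
    intro n
    have h := (mem_drT_iff.1 (hz n)).2.2 v hv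
    rw [hconst (n + 1), hconst n, hrho n, ← hm, sub_self, norm_zero] at h
    linarith
  obtain ⟨n, hn⟩ := exists_nat_gt
    ((‖(z 0).1 - v‖ ^ 2 + ((z 0).2 + f v) ^ 2 - ((z 0).2 + m) ^ 2) / (2 * -m * (f v - m)))
  have hpos : 0 < 2 * -m * (f v - m) := mul_pos (by linarith) (by linarith)
  rw [div_lt_iff₀ hpos] at hn
  exact (hbound n).not_gt hn
end

section
/- Let (x, ρ) ∈ dom f × ℝ and let (y, σ) ∈ T_{A,B}(x, ρ). If f is strictly (Fréchet) differentiable at y, then x = y + σ·∇f(y) and ρ = σ − f(y); that is, T_{A,B}⁻¹(y, σ) = (y + σ∇f(y), σ − f(y)). -/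
open Set Metric Filter
open scoped InnerProductSpace

/-- Strict (Fréchet) differentiability of the extended function encoded by `(s, f)` at
`y`, with gradient `g`: `f` is finite on a neighborhood of `y` and
`(f(u) - f(v) - ⟨g, u - v⟩)/‖u - v‖ → 0` as `u, v → y`. -/
def sdiffAt {X : Type*} [NormedAddCommGroup X] [InnerProductSpace ℝ X]
    (s : Set X) (f : X → ℝ) (g : X) (y : X) : Prop :=
  (∃ ε > 0, Metric.ball y ε ⊆ s) ∧ HasStrictFDerivAt f (innerSL ℝ g) y

/-- A point of the graph nearest to `(x, τ)` at which `f` is strictly differentiable satisfies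
the normal equation `x - y = (f y - τ) ∇f(y)`. -/
theorem sub_eq_smul_of_mem_projB {X : Type*} [NormedAddCommGroup X] [InnerProductSpace ℝ X]
    {s : Set X} {f : X → ℝ} {x y g : X} {τ r : ℝ}
    (hy : (y, r) ∈ projB s f (x, τ)) (hg : sdiffAt s f g y) :
    x - y = (f y - τ) • g := by
  obtain ⟨⟨ε, hε, hball⟩, hf⟩ := hg
  obtain ⟨⟨-, hr⟩, hmin⟩ := hy
  replace hr : f y = r := hr
  have hloc : IsLocalMin (fun u => ‖x - u‖ ^ 2 + (τ - f u) ^ 2) y := by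
    filter_upwards [Metric.ball_mem_nhds y hε] with u hu
    have h := hmin (u, f u) ⟨hball hu, rfl⟩
    unfold dist2 at h
    rw [Real.sqrt_le_sqrt_iff (by positivity)] at h
    simpa [hr] using h
  have hd := (((hasFDerivAt_id y).const_sub x).norm_sq).add
    ((hf.hasFDerivAt.const_sub τ).pow 2)
  have h0 := hloc.hasFDerivAt_eq_zero hd
  refine ext_inner_right ℝ fun v => ?_
  have hv := DFunLike.congr_fun h0 v
  simp at hv
  rw [real_inner_smul_left, inner_sub_left]
  linarith

/-- If `(x, ρ) ∈ dom f × ℝ`, `(y, σ) ∈ T_{A,B}(x, ρ)` and `f` is strictly differentiable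
at `y` with gradient `∇f(y)`, then `x = y + σ ∇f(y)` and `ρ = σ - f(y)`; that is,
`T_{A,B}⁻¹(y, σ) = (y + σ ∇f(y), σ - f(y))`. -/
theorem stmt12 {X : Type*} [NormedAddCommGroup X] [InnerProductSpace ℝ X]
    [FiniteDimensional ℝ X]
    (s : Set X) (f : X → ℝ) (hs : s.Nonempty) (hB : IsClosed (grph s f))
    (x : X) (hx : x ∈ s) (ρ : ℝ) (y : X) (σ : ℝ)
    (hstep : (y, σ) ∈ drT s f (x, ρ))
    (g : X) (hg : sdiffAt s f g y) :
    x = y + σ • g ∧ ρ = σ - f y := by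
  obtain ⟨⟨p, r⟩, hb, hw⟩ := hstep
  obtain ⟨h₁, h₂⟩ := Prod.ext_iff.1 hw
  have hyp : y = p := by
    simpa [reflA, two_nsmul, ← two_smul ℝ p, smul_smul] using h₁
  subst hyp
  have hr : f y = r := hb.1.2
  have hσ : σ = ρ + f y := by
    simp [reflA] at h₂
    linarith
  have hnormal := sub_eq_smul_of_mem_projB hb hg
  refine ⟨?_, by linarith⟩
  rw [← sub_eq_iff_eq_add', hnormal, hσ, sub_neg_eq_add, add_comm]
end

section
/- Let X be a Euclidean space and let a ∈ X. Define the continuous linear map L : X × ℝ → X × ℝ by L(u, t) := (u + t·a, t − ⟨a, u⟩). Then L is invertible, and the operator norm of L⁻¹ equals 1 if dim X > 1, and equals 1/√(1 + ‖a‖²) if dim X = 1. (This map is the Jacobian of T_{A,B}⁻¹ at a point (x̄, 0) ∈ A ∩ B with a = ∇f(x̄).) -/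
open scoped InnerProductSpace

section

variable {X : Type*} [NormedAddCommGroup X] [InnerProductSpace ℝ X]

theorem norm_sq_add_smul_add_sq_sub_inner (a u : X) (t : ℝ) :
    ‖u + t • a‖ ^ 2 + (t - ⟪a, u⟫_ℝ) ^ 2 =
      ‖u‖ ^ 2 + ⟪a, u⟫_ℝ ^ 2 + t ^ 2 * (1 + ‖a‖ ^ 2) := by
  rw [norm_add_sq_real, real_inner_smul_right, norm_smul, mul_pow, Real.norm_eq_abs, sq_abs,
    real_inner_comm]
  ring

theorem bijective_add_smul_sub_inner (a : X) :
    Function.Bijective fun z : X × ℝ => (z.1 + z.2 • a, z.2 - ⟪a, z.1⟫_ℝ) := by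
  have hs : (1 + ‖a‖ ^ 2 : ℝ) ≠ 0 := by positivity
  refine Function.bijective_iff_has_inverse.2
    ⟨fun w => (w.1 - ((w.2 + ⟪a, w.1⟫_ℝ) / (1 + ‖a‖ ^ 2)) • a,
      (w.2 + ⟪a, w.1⟫_ℝ) / (1 + ‖a‖ ^ 2)), ?_, ?_⟩
  · rintro ⟨u, t⟩
    have ht : (t - ⟪a, u⟫_ℝ + ⟪a, u + t • a⟫_ℝ) / (1 + ‖a‖ ^ 2) = t := by
      rw [inner_add_right, real_inner_smul_right, real_inner_self_eq_norm_sq, div_eq_iff hs]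
      ring
    simp only [ht, add_sub_cancel_right]
  · rintro ⟨v, r⟩
    refine Prod.ext (sub_add_cancel _ _) ?_
    simp only [inner_sub_right, real_inner_smul_right, real_inner_self_eq_norm_sq]
    field_simp
    ring

theorem exists_norm_eq_one_inner_eq_zero [FiniteDimensional ℝ X]
    (h : 1 < Module.finrank ℝ X) (a : X) : ∃ u : X, ‖u‖ = 1 ∧ ⟪a, u⟫_ℝ = 0 := by
  have hker : LinearMap.ker (innerₛₗ ℝ a) ≠ ⊥ :=
    LinearMap.ker_ne_bot_of_finrank_lt (by simpa using h)
  obtain ⟨v, hv, hv0⟩ := Submodule.exists_mem_ne_zero_of_ne_bot hker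
  have hav : ⟪a, v⟫_ℝ = 0 := by simpa using hv
  exact ⟨‖v‖⁻¹ • v, norm_smul_inv_norm (𝕜 := ℝ) hv0, by rw [real_inner_smul_right, hav, mul_zero]⟩

theorem real_inner_sq_of_finrank_eq_one (h : Module.finrank ℝ X = 1) (a u : X) :
    ⟪a, u⟫_ℝ ^ 2 = ‖a‖ ^ 2 * ‖u‖ ^ 2 := by
  rcases eq_or_ne a 0 with rfl | ha
  · simp
  · obtain ⟨c, rfl⟩ := (finrank_eq_one_iff_of_nonzero' a ha).1 h u
    rw [real_inner_smul_right, real_inner_self_eq_norm_sq, norm_smul, mul_pow ‖c‖,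
      Real.norm_eq_abs, sq_abs]
    ring

end

/-- Let `X` be a Euclidean space, `a ∈ X`, and `L(u, t) := (u + t a, t - ⟨a, u⟩)` on
`X × ℝ` (equipped with the product inner product, so the norm of `(u, t)` is
`√(‖u‖² + t²)`).  Then `L` is invertible, and for any (two-sided) inverse `Li` of `L`,
the operator norm of `Li` — i.e. the least upper bound of `‖Li z‖` over `‖z‖ ≤ 1` —
equals `1` if `dim X > 1`, and equals `1/√(1 + ‖a‖²)` if `dim X = 1`. -/
theorem stmt13 {X : Type*} [NormedAddCommGroup X] [InnerProductSpace ℝ X]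
    [FiniteDimensional ℝ X]
    (a : X) (L : X × ℝ → X × ℝ)
    (hL : ∀ (u : X) (t : ℝ), L (u, t) = (u + t • a, t - ⟪a, u⟫_ℝ)) :
    Function.Bijective L ∧
    ∀ Li : X × ℝ → X × ℝ, Function.LeftInverse Li L → Function.RightInverse Li L →
      (1 < Module.finrank ℝ X →
        IsLUB {c : ℝ | ∃ z : X × ℝ, Real.sqrt (‖z.1‖ ^ 2 + z.2 ^ 2) ≤ 1 ∧
          c = Real.sqrt (‖(Li z).1‖ ^ 2 + (Li z).2 ^ 2)} 1) ∧
      (Module.finrank ℝ X = 1 →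
        IsLUB {c : ℝ | ∃ z : X × ℝ, Real.sqrt (‖z.1‖ ^ 2 + z.2 ^ 2) ≤ 1 ∧
          c = Real.sqrt (‖(Li z).1‖ ^ 2 + (Li z).2 ^ 2)}
          (1 / Real.sqrt (1 + ‖a‖ ^ 2))) := by
  have hL' : L = fun z : X × ℝ => (z.1 + z.2 • a, z.2 - ⟪a, z.1⟫_ℝ) := funext fun z => hL z.1 z.2
  refine ⟨hL' ▸ bijective_add_smul_sub_inner a, fun Li hleft hright => ?_⟩
  have hnorm (z : X × ℝ) : ‖z.1‖ ^ 2 + z.2 ^ 2 = ‖(Li z).1‖ ^ 2 + ⟪a, (Li z).1⟫_ℝ ^ 2 +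
      (Li z).2 ^ 2 * (1 + ‖a‖ ^ 2) := by
    rw [← norm_sq_add_smul_add_sq_sub_inner]
    have hz := hright z
    rw [hL'] at hz
    nth_rewrite 1 2 [← hz]
    rfl
  refine ⟨fun hdim => IsGreatest.isLUB ⟨?_, ?_⟩, fun hdim => IsGreatest.isLUB ?_⟩
  · obtain ⟨u, hu, hau⟩ := exists_norm_eq_one_inner_eq_zero hdim a
    have hfix : Li (u, 0) = (u, 0) := by
      have := hleft (u, 0)
      rwa [hL, hau, zero_smul, add_zero, sub_zero] at this
    exact ⟨(u, 0), by simp [hu], by simp [hfix, hu]⟩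
  · rintro _ ⟨z, hz, rfl⟩
    refine (Real.sqrt_le_sqrt ?_).trans hz
    rw [hnorm z]
    nlinarith [sq_nonneg ⟪a, (Li z).1⟫_ℝ, mul_nonneg (sq_nonneg (Li z).2) (sq_nonneg ‖a‖)]
  · have hscale (z : X × ℝ) : √(‖(Li z).1‖ ^ 2 + (Li z).2 ^ 2) =
        √(‖z.1‖ ^ 2 + z.2 ^ 2) / √(1 + ‖a‖ ^ 2) := by
      rw [← Real.sqrt_div' _ (by positivity), hnorm z, real_inner_sq_of_finrank_eq_one hdim]
      congr 1
      field_simp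
    refine ⟨⟨(0, 1), by simp, by simp [hscale]⟩, ?_⟩
    rintro _ ⟨z, hz, rfl⟩
    rw [hscale]
    gcongr
end

section
/- Let x̄ ∈ X with f(x̄) = 0, and suppose f is continuously differentiable on a neighborhood of x̄ with ∇f(x̄) ≠ 0. Set z̄ := (x̄, 0) ∈ A ∩ B. Then there exists δ > 0 such that every DR sequence (z_n) with z_0 ∈ B(z̄, δ) converges R-linearly to a point of A ∩ B, i.e. there exist z* ∈ A ∩ B, η ≥ 0 and κ ∈ [0, 1) with ‖z_n − z*‖ ≤ η·κⁿ for all n. -/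
open Set Metric Filter
open scoped InnerProductSpace

/-- A small perturbation `m` of `α` in one linearized Douglas–Rachford step still contracts the
weighted energy `t ^ 2 + α * ρ ^ 2`. -/
lemma perturbed_energy_le {α m t ρ τ σ : ℝ} (hα : 0 < α) (hm : |m - α| ≤ min α (α ^ 2) / 16)
    (hτ : τ * (1 + m) = t - m * ρ) (hσ : σ * (1 + m) = ρ + t) :
    τ ^ 2 + α * σ ^ 2 ≤ (1 + α / 2)⁻¹ * (t ^ 2 + α * ρ ^ 2) := by
  set e := min α (α ^ 2) / 16 with he
  have he₁ : e ≤ α / 16 := by have := min_le_left α (α ^ 2); linarith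
  have he₂ : e ≤ α ^ 2 / 16 := by have := min_le_right α (α ^ 2); linarith
  have he₀ : 0 ≤ e := (abs_nonneg _).trans hm
  obtain ⟨hm₁, hm₂⟩ := abs_le.1 hm
  have hmpos : 0 < 1 + m := by linarith
  have hsq : (1 + 15 / 16 * α) ^ 2 ≤ (1 + m) ^ 2 := by
    apply pow_le_pow_left₀ <;> linarith
  have hmsq : m ^ 2 ≤ (17 / 16 * α) ^ 2 := by
    apply pow_le_pow_left₀ <;> linarith
  have hcross : 2 * (α - m) * (ρ * t) ≤ e * (t ^ 2 + ρ ^ 2) := by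
    have h₁ : 2 * |ρ * t| ≤ t ^ 2 + ρ ^ 2 := by
      rw [abs_mul]
      nlinarith [sq_nonneg (|ρ| - |t|), sq_abs ρ, sq_abs t]
    have h₂ : (α - m) * (ρ * t) ≤ e * |ρ * t| := by
      refine (le_abs_self _).trans ?_
      rw [abs_mul, abs_sub_comm]
      gcongr
    nlinarith
  have hcoeff₁ : (1 + α / 2) * (1 + α + e) ≤ (1 + m) ^ 2 := by
    refine le_trans ?_ hsq
    nlinarith [mul_le_mul_of_nonneg_left he₁ hα.le]
  have hcoeff₂ : (1 + α / 2) * (m ^ 2 + α + e) ≤ (1 + m) ^ 2 * α := by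
    have h₁ : (1 + α / 2) * (m ^ 2 + α + e)
        ≤ (1 + α / 2) * ((17 / 16 * α) ^ 2 + α + α ^ 2 / 16) := by gcongr
    have h₂ : (1 + 15 / 16 * α) ^ 2 * α ≤ (1 + m) ^ 2 * α := by gcongr
    refine h₁.trans (le_trans ?_ h₂)
    nlinarith [pow_pos hα 2, pow_pos hα 3]
  rw [inv_mul_eq_div, le_div_iff₀ (by positivity)]
  refine le_of_mul_le_mul_left ?_ (pow_pos hmpos 2)
  calc (1 + m) ^ 2 * ((τ ^ 2 + α * σ ^ 2) * (1 + α / 2))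
      = (1 + α / 2) * ((τ * (1 + m)) ^ 2 + α * (σ * (1 + m)) ^ 2) := by ring
    _ = (1 + α / 2) * ((1 + α) * t ^ 2 + (m ^ 2 + α) * ρ ^ 2 + 2 * (α - m) * (ρ * t)) := by
        rw [hτ, hσ]; ring
    _ ≤ (1 + α / 2) * ((1 + α) * t ^ 2 + (m ^ 2 + α) * ρ ^ 2 + e * (t ^ 2 + ρ ^ 2)) := by gcongr
    _ = ((1 + α / 2) * (1 + α + e)) * t ^ 2 + ((1 + α / 2) * (m ^ 2 + α + e)) * ρ ^ 2 := by ring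
    _ ≤ (1 + m) ^ 2 * t ^ 2 + ((1 + m) ^ 2 * α) * ρ ^ 2 := by gcongr
    _ = (1 + m) ^ 2 * (t ^ 2 + α * ρ ^ 2) := by ring

lemma abs_add_le_sqrt_energy {α : ℝ} (hα : 0 < α) (t ρ : ℝ) :
    |t + ρ| ≤ √(1 + α⁻¹) * √(t ^ 2 + α * ρ ^ 2) := by
  rw [← Real.sqrt_mul (by positivity)]
  refine Real.abs_le_sqrt ?_
  have h : (1 + α⁻¹) * (t ^ 2 + α * ρ ^ 2) = (t + ρ) ^ 2 + α⁻¹ * (t - α * ρ) ^ 2 := by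
    field_simp; ring
  rw [h]
  have : 0 ≤ α⁻¹ * (t - α * ρ) ^ 2 := by positivity
  linarith

/-- A Douglas–Rachford step moves `(x, ρ)` to `(p, ρ + f p)`, where `p` minimizes
`‖x - y‖ ^ 2 + (ρ + f y) ^ 2` over `y ∈ s`. -/
lemma drT_step {X : Type*} [NormedAddCommGroup X] [Module ℝ X] {s : Set X} {f : X → ℝ}
    {z w : X × ℝ} (hw : w ∈ drT s f z) :
    w.2 = z.2 + f w.1 ∧
      ∀ y ∈ s, ‖z.1 - w.1‖ ^ 2 + (z.2 + f w.1) ^ 2 ≤ ‖z.1 - y‖ ^ 2 + (z.2 + f y) ^ 2 := by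
  obtain ⟨b, ⟨⟨hbs, hfb⟩, hmin⟩, rfl⟩ := hw
  have h₁ : ((2 : ℝ)⁻¹ • (z + (2 • b - reflA z))).1 = b.1 := by
    have : z.1 + (2 • b.1 - z.1) = (2 : ℝ) • b.1 := by rw [two_smul, two_smul]; abel
    change (2 : ℝ)⁻¹ • (z.1 + (2 • b.1 - z.1)) = b.1
    rw [this, inv_smul_smul₀ two_ne_zero]
  have h₂ : ((2 : ℝ)⁻¹ • (z + (2 • b - reflA z))).2 = z.2 + b.2 := by
    simp [reflA]; ring
  rw [h₁, h₂, hfb]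
  refine ⟨rfl, fun y hy => ?_⟩
  have h := hmin (y, f y) ⟨hy, rfl⟩
  have h' := (Real.sqrt_le_sqrt_iff (by positivity)).1 h
  simp only [reflA] at h'
  nlinarith

/-- First-order optimality for the minimization defining a Douglas–Rachford step. -/
lemma sub_eq_smul_of_isLocalMin {X : Type*} [NormedAddCommGroup X] [InnerProductSpace ℝ X]
    {f : X → ℝ} {x p v : X} {ρ : ℝ} (hf : HasFDerivAt f (innerSL ℝ v) p)
    (hmin : IsLocalMin (fun y => ‖x - y‖ ^ 2 + (ρ + f y) ^ 2) p) :
    x - p = (ρ + f p) • v := by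
  have hd := ((hasFDerivAt_id p).const_sub x).norm_sq.add ((hf.const_add ρ).pow 2)
  have h0 := hmin.hasFDerivAt_eq_zero hd
  refine ext_inner_right ℝ fun u => ?_
  have hu := DFunLike.congr_fun h0 u
  simp at hu
  rw [inner_smul_left]
  simp only [conj_trivial, inner_sub_left] at *
  linarith

/-- One Douglas–Rachford step inside a convex set on which the gradients are nearly constant. -/
lemma energy_step_le {X : Type*} [NormedAddCommGroup X] [InnerProductSpace ℝ X]
    {s U : Set X} {f : X → ℝ} {g : X → X} {α : ℝ} (hα : 0 < α) (hU : IsOpen U)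
    (hUc : Convex ℝ U) (hUs : U ⊆ s) (hf : ∀ x ∈ U, HasFDerivAt f (innerSL ℝ (g x)) x)
    (hg : ∀ x ∈ U, ∀ y ∈ U, |⟪g x, g y⟫_ℝ - α| ≤ min α (α ^ 2) / 16)
    {z w : X × ℝ} (hw : w ∈ drT s f z) (hzU : z.1 ∈ U) (hwU : w.1 ∈ U) :
    f w.1 ^ 2 + α * w.2 ^ 2 ≤ (1 + α / 2)⁻¹ * (f z.1 ^ 2 + α * z.2 ^ 2) := by
  obtain ⟨hw₂, hmin⟩ := drT_step hw
  have hloc : IsLocalMin (fun y => ‖z.1 - y‖ ^ 2 + (z.2 + f y) ^ 2) w.1 := by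
    filter_upwards [hU.mem_nhds hwU] with y hy using hmin y (hUs hy)
  have hstat := sub_eq_smul_of_isLocalMin (hf _ hwU) hloc
  rw [← hw₂] at hstat
  obtain ⟨ξ, hξ, hmv⟩ := domain_mvt (fun x hx => (hf x hx).hasFDerivWithinAt) hUc hwU hzU
  have hξU : ξ ∈ U := hUc.segment_subset hwU hzU hξ
  rw [hstat, innerSL_apply_apply, inner_smul_right] at hmv
  refine perturbed_energy_le hα (hg ξ hξU w.1 hwU) ?_ ?_ <;> grind

lemma norm_step_le {X : Type*} [NormedAddCommGroup X] [Module ℝ X] {s : Set X}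
    {f : X → ℝ} {α : ℝ} (hα : 0 < α) {z w : X × ℝ} (hw : w ∈ drT s f z) (hz : z.1 ∈ s) :
    ‖z.1 - w.1‖ ≤ √(1 + α⁻¹) * √(f z.1 ^ 2 + α * z.2 ^ 2) := by
  refine le_trans ?_ (abs_add_le_sqrt_energy hα (f z.1) z.2)
  have h := (drT_step hw).2 z.1 hz
  rw [sub_self, norm_zero] at h
  rw [← abs_of_nonneg (norm_nonneg (z.1 - w.1))]
  refine sq_le_sq.1 ?_
  nlinarith [sq_nonneg (z.2 + f w.1)]

/-- If each step from a point of a ball is controlled by an energy `W`, and `W` contracts as long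
as the iterates stay in the ball, then iterates that start close enough to the center with small
energy never leave the ball and have geometrically decaying energy. -/
lemma geometric_trapping {X : Type*} [PseudoMetricSpace X] {c : X} {r C q : ℝ} (hC : 0 ≤ C)
    (hq₀ : 0 ≤ q) (hq₁ : q < 1) {x : ℕ → X} {W : ℕ → ℝ} (hW : 0 ≤ W 0)
    (h₀ : dist (x 0) c + C * W 0 / (1 - q) < r)
    (hstep : ∀ n, x n ∈ ball c r → dist (x n) (x (n + 1)) ≤ C * W n)
    (hcontr : ∀ n, x n ∈ ball c r → x (n + 1) ∈ ball c r → W (n + 1) ≤ q * W n) (n : ℕ) :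
    dist (x n) c ≤ dist (x 0) c + C * W 0 / (1 - q) ∧ W n ≤ W 0 * q ^ n := by
  have hq : 0 < 1 - q := by linarith
  have hCW : 0 ≤ C * W 0 / (1 - q) := by positivity
  have hle : ∀ k, C * W 0 / (1 - q) * (1 - q ^ k) ≤ C * W 0 / (1 - q) := fun k =>
    mul_le_of_le_one_right hCW (by linarith [pow_nonneg hq₀ k])
  suffices h : dist (x n) c ≤ dist (x 0) c + C * W 0 / (1 - q) * (1 - q ^ n) ∧
      W n ≤ W 0 * q ^ n from ⟨h.1.trans (by linarith [hle n]), h.2⟩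
  induction n with
  | zero => simp
  | succ n ih =>
    obtain ⟨ihx, ihW⟩ := ih
    have hn : x n ∈ ball c r := mem_ball.2 (by linarith [hle n])
    have hd : dist (x (n + 1)) c ≤
        dist (x 0) c + C * W 0 / (1 - q) * (1 - q ^ (n + 1)) := by
      have h₁ : dist (x n) (x (n + 1)) ≤ C * (W 0 * q ^ n) :=
        (hstep n hn).trans (by gcongr)
      have h₂ : C * W 0 / (1 - q) * (1 - q ^ (n + 1)) =
          C * W 0 / (1 - q) * (1 - q ^ n) + C * (W 0 * q ^ n) := by
        field_simp; ring
      have h₃ := dist_triangle_left (x (n + 1)) c (x n)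
      linarith
    have hn' : x (n + 1) ∈ ball c r := mem_ball.2 (by linarith [hle (n + 1)])
    refine ⟨hd, (hcontr n hn hn').trans ?_⟩
    calc q * W n ≤ q * (W 0 * q ^ n) := by gcongr
      _ = W 0 * q ^ (n + 1) := by ring

lemma dist_le_dist2 {X : Type*} [NormedAddCommGroup X] (z w : X × ℝ) :
    dist z w ≤ dist2 z w := by
  rw [Prod.dist_eq, dist_eq_norm, Real.dist_eq]
  refine max_le (Real.le_sqrt_of_sq_le ?_) (Real.abs_le_sqrt ?_)
  · linarith [sq_nonneg (z.2 - w.2)]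
  · linarith [sq_nonneg ‖z.1 - w.1‖]

lemma dist2_le_add {X : Type*} [NormedAddCommGroup X] (z w : X × ℝ) :
    dist2 z w ≤ dist z.1 w.1 + |z.2 - w.2| := by
  rw [dist_eq_norm]
  refine Real.sqrt_le_iff.2 ⟨by positivity, ?_⟩
  nlinarith [sq_abs (z.2 - w.2), mul_nonneg (norm_nonneg (z.1 - w.1)) (abs_nonneg (z.2 - w.2))]

/-- Local `R`-linear convergence of the DRA.  Suppose `f(x̄) = 0` and `f` is
continuously differentiable on a neighborhood of `x̄` (gradient function `g`,
`HasFDerivAt` on a ball about `x̄`, `g` continuous there) with `∇f(x̄) ≠ 0`.  Set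
`z̄ := (x̄, 0) ∈ A ∩ B`.  Then there is `δ > 0` such that every DR sequence starting in
the closed (Euclidean) ball of radius `δ` about `z̄` converges `R`-linearly to a point
of `A ∩ B`: there are `z* ∈ A ∩ B`, `η ≥ 0` and `κ ∈ [0, 1)` with
`‖z_n - z*‖ ≤ η κⁿ` for all `n`. -/
theorem stmt15 {X : Type*} [NormedAddCommGroup X] [InnerProductSpace ℝ X]
    [FiniteDimensional ℝ X]
    (s : Set X) (f : X → ℝ) (hs : s.Nonempty) (hB : IsClosed (grph s f))
    (xbar : X) (hxs : xbar ∈ s) (hfx : f xbar = 0)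
    (g : X → X) (ε₀ : ℝ) (hε₀ : 0 < ε₀) (hball : Metric.ball xbar ε₀ ⊆ s)
    (hderiv : ∀ x ∈ Metric.ball xbar ε₀, HasFDerivAt f (innerSL ℝ (g x)) x)
    (hcont : ContinuousOn g (Metric.ball xbar ε₀))
    (hne : g xbar ≠ 0) :
    ∃ δ > 0, ∀ z : ℕ → X × ℝ, dist2 (z 0) (xbar, (0 : ℝ)) ≤ δ →
      (∀ n, z (n + 1) ∈ drT s f (z n)) →
      ∃ zstar : X × ℝ, (zstar.2 = 0 ∧ zstar.1 ∈ s ∧ f zstar.1 = 0) ∧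
        ∃ η : ℝ, 0 ≤ η ∧ ∃ κ : ℝ, 0 ≤ κ ∧ κ < 1 ∧
          ∀ n, dist2 (z n) zstar ≤ η * κ ^ n := by
  set α : ℝ := ⟪g xbar, g xbar⟫_ℝ with hαdef
  have hα : 0 < α := real_inner_self_pos.2 hne
  have hgc : ContinuousAt g xbar := hcont.continuousAt (ball_mem_nhds _ hε₀)
  obtain ⟨r, hr, hrε, hgr⟩ : ∃ r > 0, r ≤ ε₀ ∧ ∀ x ∈ ball xbar r, ∀ y ∈ ball xbar r,
      |⟪g x, g y⟫_ℝ - α| ≤ min α (α ^ 2) / 16 := by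
    have hc : ContinuousAt (fun p : X × X => ⟪g p.1, g p.2⟫_ℝ) (xbar, xbar) :=
      (hgc.comp (f := Prod.fst) (x := (xbar, xbar)) continuousAt_fst).inner
        (hgc.comp (f := Prod.snd) (x := (xbar, xbar)) continuousAt_snd)
    obtain ⟨r, hr, h⟩ := Metric.continuousAt_iff.1 hc (min α (α ^ 2) / 16) (by positivity)
    refine ⟨min r ε₀, lt_min hr hε₀, min_le_right _ _, fun x hx y hy => (@h (x, y) ?_).le⟩
    rw [Prod.dist_eq]
    exact max_lt (hx.trans_le (min_le_left _ _)) (hy.trans_le (min_le_left _ _))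
  have hrball : ball xbar r ⊆ ball xbar ε₀ := ball_subset_ball hrε
  have hfr : ∀ x ∈ ball xbar r, HasFDerivAt f (innerSL ℝ (g x)) x :=
    fun x hx => hderiv x (hrball hx)
  set C : ℝ := √(1 + α⁻¹)
  set q : ℝ := √(1 + α / 2)⁻¹
  have hq₀ : 0 ≤ q := Real.sqrt_nonneg _
  have hq₁ : q < 1 := by
    rw [Real.sqrt_lt' one_pos, one_pow]
    exact inv_lt_one_of_one_lt₀ (by linarith)
  let E : X × ℝ → ℝ := fun z => √(f z.1 ^ 2 + α * z.2 ^ 2)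
  have hfE : ∀ z, |f z.1| ≤ E z := fun z => Real.abs_le_sqrt (by
    have : 0 ≤ α * z.2 ^ 2 := by positivity
    linarith)
  have hE₂ : ∀ z, |z.2| ≤ (√α)⁻¹ * E z := fun z => by
    rw [inv_mul_eq_div, le_div_iff₀ (by positivity), ← Real.sqrt_sq_eq_abs,
      ← Real.sqrt_mul (sq_nonneg _)]
    exact Real.sqrt_le_sqrt (by nlinarith [sq_nonneg (f z.1)])
  obtain ⟨δ, hδ, hsmall⟩ : ∃ δ > 0, ∀ z : X × ℝ, dist z (xbar, (0 : ℝ)) < δ →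
      dist z.1 xbar + C * E z / (1 - q) < r := by
    have hfc : ContinuousAt f xbar := (hderiv xbar (mem_ball_self hε₀)).continuousAt
    have hfc' : ContinuousAt (fun z : X × ℝ => f z.1) (xbar, 0) :=
      hfc.comp (f := Prod.fst) (x := (xbar, (0 : ℝ))) continuousAt_fst
    have hc : ContinuousAt (fun z : X × ℝ => dist z.1 xbar + C * E z / (1 - q)) (xbar, 0) := by
      have hE : ContinuousAt E (xbar, 0) :=
        ((hfc'.pow 2).add (continuousAt_const.mul (continuousAt_snd.pow 2))).sqrt
      exact (continuousAt_fst.dist continuousAt_const).add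
        ((continuousAt_const.mul hE).div_const _)
    have hlt := hc.eventually_lt continuousAt_const
      (show dist xbar xbar + C * E (xbar, 0) / (1 - q) < r by simpa [E, hfx] using hr)
    exact Metric.eventually_nhds_iff.1 hlt |>.imp fun δ h => ⟨h.1, fun z hz => h.2 hz⟩
  refine ⟨δ / 2, by positivity, fun z hz₀ hz => ?_⟩
  have h₀ := hsmall (z 0) ((dist_le_dist2 _ _).trans_lt (by linarith))
  have htrap := geometric_trapping (x := fun n => (z n).1) (W := fun n => E (z n))
    (Real.sqrt_nonneg _) hq₀ hq₁ (Real.sqrt_nonneg _) h₀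
    (fun n hn => by
      rw [dist_eq_norm]
      exact norm_step_le hα (hz n) (hball (hrball hn)))
    (fun n hn hn' => by
      rw [← Real.sqrt_mul (by positivity)]
      exact Real.sqrt_le_sqrt (energy_step_le hα isOpen_ball (convex_ball _ _)
        (hrball.trans hball) hfr hgr (hz n) hn hn'))
  have hmem : ∀ n, (z n).1 ∈ ball xbar r := fun n => mem_ball.2 ((htrap n).1.trans_lt h₀)
  have hgeom : ∀ n, dist (z n).1 (z (n + 1)).1 ≤ C * E (z 0) * q ^ n := fun n => by
    rw [dist_eq_norm, mul_assoc]
    exact (norm_step_le hα (hz n) (hball (hrball (hmem n)))).trans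
      (mul_le_mul_of_nonneg_left (htrap n).2 (Real.sqrt_nonneg _))
  have : CompleteSpace X := FiniteDimensional.complete ℝ X
  obtain ⟨xs, hxs_lim⟩ := cauchySeq_tendsto_of_complete (cauchySeq_of_le_geometric q _ hq₁ hgeom)
  have hxs_mem : xs ∈ ball xbar r := mem_ball.2 <| lt_of_le_of_lt
    (le_of_tendsto' (hxs_lim.dist tendsto_const_nhds) fun n => (htrap n).1) h₀
  have hpow : Tendsto (fun n => E (z 0) * q ^ n) atTop (nhds 0) := by
    simpa using (tendsto_pow_atTop_nhds_zero_of_lt_one hq₀ hq₁).const_mul (E (z 0))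
  have hfxs : f xs = 0 := tendsto_nhds_unique
    ((hfr xs hxs_mem).continuousAt.tendsto.comp hxs_lim)
    (squeeze_zero_norm (fun n => (hfE (z n)).trans (htrap n).2) hpow)
  have hq : 0 < 1 - q := by linarith
  refine ⟨(xs, 0), ⟨rfl, hball (hrball hxs_mem), hfxs⟩,
    C * E (z 0) / (1 - q) + (√α)⁻¹ * E (z 0), by positivity, q, hq₀, hq₁, fun n => ?_⟩
  have hx := dist_le_of_le_geometric_of_tendsto q _ hq₁ hgeom hxs_lim n
  have hρ : |(z n).2| ≤ (√α)⁻¹ * (E (z 0) * q ^ n) :=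
    (hE₂ (z n)).trans (mul_le_mul_of_nonneg_left (htrap n).2 (by positivity))
  calc dist2 (z n) (xs, 0) ≤ dist (z n).1 xs + |(z n).2 - 0| := dist2_le_add _ _
    _ ≤ C * E (z 0) * q ^ n / (1 - q) + (√α)⁻¹ * (E (z 0) * q ^ n) := by
        rw [sub_zero]; exact add_le_add hx hρ
    _ = (C * E (z 0) / (1 - q) + (√α)⁻¹ * E (z 0)) * q ^ n := by ring
end

section
/- Let X be a Euclidean space, let α ∈ ℝ ∖ {0} and p > 0, and let f : X → ℝ be given by f(x) := α‖x‖^p. Then every DR sequence (z_n) for the pair (A, B) with B the graph of f converges to a point z̄ ∈ X × ℝ whose first coordinate is 0, i.e. P_A(z̄) = (0, 0) ∈ A ∩ B. (Global convergence of the Douglas–Rachford algorithm for f = α‖·‖^p.) -/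
open Set Metric Filter
open scoped InnerProductSpace

/-- First-order optimality along the ray through a minimizer `y` of
`‖x - ·‖² + (ρ + α ‖·‖ ^ p)²`. -/
lemma inner_sub_eq_of_forall_le {X : Type*} [NormedAddCommGroup X] [InnerProductSpace ℝ X]
    {α p ρ : ℝ} {x y : X}
    (hmin : ∀ w : X, ‖x - y‖ ^ 2 + (ρ + α * ‖y‖ ^ p) ^ 2
      ≤ ‖x - w‖ ^ 2 + (ρ + α * ‖w‖ ^ p) ^ 2) :
    ⟪x - y, y⟫_ℝ = p * (ρ + α * ‖y‖ ^ p) * (α * ‖y‖ ^ p) := by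
  set g : ℝ → ℝ := fun s => ‖x - s • y‖ ^ 2 + (ρ + α * (s ^ p * ‖y‖ ^ p)) ^ 2 with hg
  have hlocal : IsLocalMin g 1 := by
    filter_upwards [lt_mem_nhds (zero_lt_one' ℝ)] with s hs
    have h := hmin (s • y)
    rw [norm_smul, Real.norm_eq_abs, abs_of_pos hs,
      Real.mul_rpow hs.le (norm_nonneg y)] at h
    simpa [hg] using h
  have hray : HasDerivAt (fun s : ℝ => x - s • y) (-y) 1 := by
    simpa using ((hasDerivAt_id (1 : ℝ)).smul_const y).const_sub x
  have hpow : HasDerivAt (fun s : ℝ => ρ + α * (s ^ p * ‖y‖ ^ p)) (α * (p * ‖y‖ ^ p)) 1 := by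
    have h := Real.hasDerivAt_rpow_const (x := 1) (p := p) (Or.inl one_ne_zero)
    simpa using ((h.mul_const (‖y‖ ^ p)).const_mul α).const_add ρ
  have hzero := hlocal.hasDerivAt_eq_zero (hray.norm_sq.add (hpow.pow 2))
  simp only [one_smul, inner_neg_right, Real.one_rpow] at hzero
  norm_num at hzero
  linarith

/-- Convergence of the iteration `(x, ρ) ↦ (y, ρ + α ‖y‖ ^ p)`, where `y` minimizes
`‖x - ·‖² + (ρ + α ‖·‖ ^ p)²`, when `α > 0`. -/
lemma tendsto_of_forall_le_of_pos {X : Type*} [NormedAddCommGroup X] [InnerProductSpace ℝ X]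
    {α p : ℝ} (hα : 0 < α) (hp : 0 < p) {x : ℕ → X} {ρ : ℕ → ℝ}
    (hρ : ∀ n, ρ (n + 1) = ρ n + α * ‖x (n + 1)‖ ^ p)
    (hmin : ∀ n (w : X), ‖x n - x (n + 1)‖ ^ 2 + (ρ n + α * ‖x (n + 1)‖ ^ p) ^ 2
      ≤ ‖x n - w‖ ^ 2 + (ρ n + α * ‖w‖ ^ p) ^ 2) :
    Tendsto x atTop (nhds 0) ∧ ∃ c, Tendsto ρ atTop (nhds c) := by
  have hmono : Monotone ρ := monotone_nat_of_le_succ fun n => by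
    rw [hρ n]
    have : 0 ≤ α * ‖x (n + 1)‖ ^ p := by positivity
    linarith
  have hbdd : BddAbove (range ρ) := by
    by_cases hpos : ∃ N, 0 < ρ N
    · obtain ⟨N, hN⟩ := hpos
      have hstep : ∀ n, N ≤ n → ‖x (n + 1)‖ ^ 2 + 2 * p * ρ N * ρ (n + 1)
          ≤ ‖x n‖ ^ 2 + 2 * p * ρ N * ρ n := by
        intro n hn
        have hinner := inner_sub_eq_of_forall_le (hmin n)
        rw [← hρ n] at hinner
        have hsq := norm_add_sq_real (x n - x (n + 1)) (x (n + 1))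
        rw [sub_add_cancel, hinner] at hsq
        have hle : p * ρ N * (α * ‖x (n + 1)‖ ^ p)
            ≤ p * ρ (n + 1) * (α * ‖x (n + 1)‖ ^ p) := by
          have := hmono (hn.trans n.le_succ)
          gcongr
        have hincr : α * ‖x (n + 1)‖ ^ p = ρ (n + 1) - ρ n := by linarith [hρ n]
        rw [hincr] at hsq hle
        nlinarith [sq_nonneg ‖x n - x (n + 1)‖]
      have henergy : ∀ n, N ≤ n → ‖x n‖ ^ 2 + 2 * p * ρ N * ρ n
          ≤ ‖x N‖ ^ 2 + 2 * p * ρ N * ρ N := fun n hn => by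
        induction n, hn using Nat.le_induction with
        | base => exact le_rfl
        | succ n hn ih => exact (hstep n hn).trans ih
      refine ⟨(‖x N‖ ^ 2 + 2 * p * ρ N * ρ N) / (2 * p * ρ N), ?_⟩
      rintro _ ⟨n, rfl⟩
      refine (hmono (le_max_left n N)).trans ?_
      rw [le_div_iff₀ (by positivity)]
      linarith [henergy _ (le_max_right n N), sq_nonneg ‖x (max n N)‖]
    · push Not at hpos
      exact ⟨0, by rintro _ ⟨n, rfl⟩; exact hpos n⟩
  have hlim := tendsto_atTop_ciSup hmono hbdd
  refine ⟨?_, _, hlim⟩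
  have hdiff : Tendsto (fun n => (α⁻¹ * (ρ (n + 1) - ρ n)) ^ p⁻¹) atTop (nhds 0) := by
    have h := (((tendsto_add_atTop_iff_nat 1).2 hlim).sub hlim).const_mul α⁻¹
    rw [sub_self, mul_zero] at h
    simpa [Real.zero_rpow (inv_ne_zero hp.ne')] using
      h.rpow_const (p := p⁻¹) (Or.inr (inv_nonneg.2 hp.le))
  rw [← tendsto_add_atTop_iff_nat 1, tendsto_zero_iff_norm_tendsto_zero]
  refine hdiff.congr fun n => ?_
  rw [hρ n, add_sub_cancel_left, inv_mul_cancel_left₀ hα.ne',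
    Real.rpow_rpow_inv (norm_nonneg _) (ne_of_gt hp)]

/-- One Douglas–Rachford step for the graph of an everywhere defined function. -/
lemma eq_and_forall_le_of_mem_drT {X : Type*} [NormedAddCommGroup X] [Module ℝ X]
    {f : X → ℝ} {z w : X × ℝ} (h : w ∈ drT Set.univ f z) :
    w.2 = z.2 + f w.1 ∧
      ∀ y : X, ‖z.1 - w.1‖ ^ 2 + (z.2 + f w.1) ^ 2 ≤ ‖z.1 - y‖ ^ 2 + (z.2 + f y) ^ 2 := by
  obtain ⟨⟨y, s⟩, ⟨⟨-, hs⟩, hb⟩, rfl⟩ := h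
  simp only at hs
  subst hs
  have hfst : ((2 : ℝ)⁻¹ • (z + (2 • (y, f y) - reflA z))).1 = y := by
    simp only [reflA, Prod.smul_fst, Prod.fst_add, Prod.fst_sub]
    rw [add_sub_cancel, ← Nat.cast_smul_eq_nsmul ℝ, smul_smul]
    norm_num
  rw [hfst]
  refine ⟨by simp [reflA]; ring, fun v => ?_⟩
  have hv := hb (v, f v) ⟨mem_univ _, rfl⟩
  simp only [dist2, reflA] at hv
  rw [Real.sqrt_le_sqrt_iff (by positivity)] at hv
  linarith

/-- Global convergence of the DRA for `f = α ‖·‖^p` (`α ≠ 0`, `p > 0`): every DR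
sequence for the pair `(A, B)` with `B` the graph of `f` (here `dom f = X`, i.e.
`s = univ`) converges to a point `z̄` whose first coordinate is `0`, i.e.
`P_A(z̄) = (0, 0) ∈ A ∩ B`. -/
theorem stmt19 {X : Type*} [NormedAddCommGroup X] [InnerProductSpace ℝ X]
    [FiniteDimensional ℝ X]
    (α p : ℝ) (hα : α ≠ 0) (hp : 0 < p)
    (z : ℕ → X × ℝ)
    (hz : ∀ n, z (n + 1) ∈ drT Set.univ (fun x : X => α * ‖x‖ ^ p) (z n)) :
    ∃ zbar : X × ℝ, Tendsto z atTop (nhds zbar) ∧ zbar.1 = 0 := by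
  have hstep := fun n => eq_and_forall_le_of_mem_drT (hz n)
  suffices h : Tendsto (fun n => (z n).1) atTop (nhds 0) ∧
      ∃ c, Tendsto (fun n => (z n).2) atTop (nhds c) by
    obtain ⟨hfst, c, hsnd⟩ := h
    exact ⟨(0, c), hfst.prodMk_nhds hsnd, rfl⟩
  rcases hα.lt_or_gt with hneg | hpos
  · obtain ⟨hfst, c, hsnd⟩ := tendsto_of_forall_le_of_pos (neg_pos.2 hneg) hp
      (x := fun n => (z n).1) (ρ := fun n => -(z n).2)
      (fun n => by linarith [(hstep n).1]) (fun n w => by nlinarith [(hstep n).2 w])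
    exact ⟨hfst, -c, by simpa using hsnd.neg⟩
  · exact tendsto_of_forall_le_of_pos hpos hp (fun n => (hstep n).1) (fun n => (hstep n).2)
end
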